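/- arXiv:1305.5828 — 3 statements merged into one kernel-verified Lean document; each statement's English description precedes it below -/
import Mathlib

section
/- Let H, G be real Hilbert spaces, f ∈ Γ₀(H) (proper lsc convex), g ∈ Γ₀(G), and L : H → G bounded linear, with 0 ∈ sri(L*(dom g*) − dom f*). Then the function (L ▷ f) □ g belongs to Γ₀(G), where L ▷ f is the infimal postcomposition y ↦ inf{f(x) : Lx = y} and □ is infimal convolution. -/
open scoped Pointwise RealInnerProductSpace

noncomputable section

/-- Inverse of a set-valued operator (graph reversal). -/
def SVInv {α β : Type*} (A : α → Set β) : β → Set α := fun u => {x | u ∈ A x}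

/-- Range of a set-valued operator. -/
def SVRan {α β : Type*} (A : α → Set β) : Set β := ⋃ x, A x

/-- Parallel sum of set-valued operators: `A □ B = (A⁻¹ + B⁻¹)⁻¹`. -/
def parSum {α : Type*} [Add α] (A B : α → Set α) : α → Set α :=
  SVInv fun u => SVInv A u + SVInv B u

/-- Parallel composition of `A` by `L`: `L ▷ A = (L ∘ A⁻¹ ∘ L*)⁻¹`. -/
def parComp {H G : Type*} [NormedAddCommGroup H] [InnerProductSpace ℝ H] [CompleteSpace H]
    [NormedAddCommGroup G] [InnerProductSpace ℝ G] [CompleteSpace G]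
    (L : H →L[ℝ] G) (A : H → Set H) : G → Set G :=
  SVInv fun v => L '' SVInv A (ContinuousLinearMap.adjoint L v)

/-- Monotonicity of a set-valued operator. -/
def IsMonotoneOp {H : Type*} [NormedAddCommGroup H] [InnerProductSpace ℝ H]
    (A : H → Set H) : Prop :=
  ∀ x y u v, u ∈ A x → v ∈ A y → (0:ℝ) ≤ ⟪x - y, u - v⟫

/-- Maximal monotonicity: no monotone operator has a strictly larger graph. -/
def IsMaxMonotoneOp {H : Type*} [NormedAddCommGroup H] [InnerProductSpace ℝ H]
    (A : H → Set H) : Prop :=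
  IsMonotoneOp A ∧ ∀ B : H → Set H, IsMonotoneOp B → (∀ x, A x ⊆ B x) → B = A

/-- The cone generated by a set. -/
def coneGen {H : Type*} [AddCommGroup H] [Module ℝ H] (D : Set H) : Set H :=
  {z | ∃ c : ℝ, 0 ≤ c ∧ ∃ y ∈ D, z = c • y}

/-- The cone generated by `D` is a closed vector subspace. -/
def IsClosedSubspaceCone {H : Type*} [NormedAddCommGroup H] [Module ℝ H]
    (D : Set H) : Prop :=
  ∃ S : Submodule ℝ H, IsClosed (S : Set H) ∧ coneGen D = ↑S

/-- Effective domain of an `EReal`-valued function. -/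
def effDom {H : Type*} (f : H → EReal) : Set H := {x | f x ≠ ⊤}

/-- Properness. -/
def ProperFn {H : Type*} (f : H → EReal) : Prop := (∀ x, f x ≠ ⊥) ∧ ∃ x, f x ≠ ⊤

/-- Convexity for `EReal`-valued functions. -/
def ConvexERealFn {H : Type*} [AddCommGroup H] [Module ℝ H] (f : H → EReal) : Prop :=
  ∀ x y : H, ∀ a b : ℝ, 0 ≤ a → 0 ≤ b → a + b = 1 →
    f (a • x + b • y) ≤ (a : EReal) * f x + (b : EReal) * f y

/-- The class `Γ₀`: proper, convex, lower semicontinuous. -/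
def IsGamma0 {H : Type*} [NormedAddCommGroup H] [NormedSpace ℝ H] (f : H → EReal) : Prop :=
  ProperFn f ∧ ConvexERealFn f ∧ LowerSemicontinuous f

/-- Fenchel conjugate. -/
def fconj {H : Type*} [NormedAddCommGroup H] [InnerProductSpace ℝ H]
    (f : H → EReal) (u : H) : EReal :=
  ⨆ x, ((⟪x, u⟫ : ℝ) : EReal) - f x

/-- Infimal convolution. -/
def infConv {H : Type*} [Sub H] (f g : H → EReal) (x : H) : EReal := ⨅ y, f (x - y) + g y

/-- Infimal postcomposition `(L ▷ f)(y) = inf {f x : L x = y}`. -/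
def infPost {H G : Type*} [NormedAddCommGroup H] [NormedSpace ℝ H]
    [NormedAddCommGroup G] [NormedSpace ℝ G]
    (L : H →L[ℝ] G) (f : H → EReal) (y : G) : EReal :=
  ⨅ x : {x : H // L x = y}, f x.1

/-- Convex subdifferential of an `EReal`-valued function. -/
def subdiffFn {H : Type*} [NormedAddCommGroup H] [InnerProductSpace ℝ H]
    (f : H → EReal) (x : H) : Set H :=
  {u | ∀ y, f x + ((⟪y - x, u⟫ : ℝ) : EReal) ≤ f y}

/-- `x` belongs to the strong relative interior of `C`. -/
def sriMem {H : Type*} [NormedAddCommGroup H] [Module ℝ H] (C : Set H) (x : H) : Prop :=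
  x ∈ C ∧ IsClosedSubspaceCone ((fun y => y - x) '' C)

/-- Pairs `(u, c)` such that the affine function `⟪·, u⟫ - c` is a minorant of `f`, that is, the
epigraph of the Fenchel conjugate of `f`. -/
def affMinorants {H : Type*} [NormedAddCommGroup H] [InnerProductSpace ℝ H]
    (f : H → EReal) : Set (H × ℝ) :=
  {p | ∀ x, ((⟪x, p.1⟫ - p.2 : ℝ) : EReal) ≤ f x}

section Minorants

variable {H : Type*} [NormedAddCommGroup H] [InnerProductSpace ℝ H]

lemma fst_mem_effDom_fconj {f : H → EReal} {p : H × ℝ} (hp : p ∈ affMinorants f) :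
    p.1 ∈ effDom (fconj f) := by
  have h : fconj f p.1 ≤ (p.2 : EReal) := by
    refine iSup_le fun x => ?_
    have hx := hp x
    induction hfx : f x using EReal.rec with
    | bot => rw [hfx] at hx; exact absurd (le_bot_iff.1 hx) (EReal.coe_ne_bot _)
    | coe t =>
      rw [hfx] at hx
      have : ⟪x, p.1⟫ - p.2 ≤ t := by exact_mod_cast hx
      exact_mod_cast (by linarith : ⟪x, p.1⟫ - t ≤ p.2)
    | top => simp
  exact fun h' => EReal.coe_ne_top p.2 (top_le_iff.1 (h' ▸ h))

lemma exists_mem_affMinorants_of_mem_effDom_fconj {f : H → EReal} (hf : ProperFn f) {u : H}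
    (hu : u ∈ effDom (fconj f)) : ∃ c : ℝ, (u, c) ∈ affMinorants f := by
  have hle : ∀ x, ((⟪x, u⟫ : ℝ) : EReal) - f x ≤ fconj f u := fun x =>
    le_iSup (fun x => ((⟪x, u⟫ : ℝ) : EReal) - f x) x
  induction hc : fconj f u using EReal.rec with
  | bot =>
    obtain ⟨x, hx⟩ := hf.2
    have h := hle x
    rw [hc, le_bot_iff] at h
    lift f x to ℝ using ⟨hx, hf.1 x⟩ with t
    exact absurd h (by exact_mod_cast EReal.coe_ne_bot (⟪x, u⟫ - t))
  | coe c =>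
    refine ⟨c, fun x => ?_⟩
    have h := hle x
    rw [hc] at h
    induction hfx : f x using EReal.rec with
    | bot => exact absurd hfx (hf.1 x)
    | coe t =>
      rw [hfx] at h
      have : ⟪x, u⟫ - t ≤ c := by exact_mod_cast h
      exact_mod_cast (by linarith : ⟪x, u⟫ - c ≤ t)
    | top => exact le_top
  | top => exact absurd hc hu

lemma IsGamma0.isClosed_realEpigraph {f : H → EReal} (hf : IsGamma0 f) :
    IsClosed {p : H × ℝ | f p.1 ≤ (p.2 : EReal)} :=
  hf.2.2.isClosed_epigraph.preimage
    (continuous_fst.prodMk (continuous_coe_real_ereal.comp continuous_snd))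

lemma IsGamma0.convex_realEpigraph {f : H → EReal} (hf : IsGamma0 f) :
    Convex ℝ {p : H × ℝ | f p.1 ≤ (p.2 : EReal)} := by
  intro p hp q hq a b ha hb hab
  refine (hf.2.1 p.1 q.1 a b ha hb hab).trans ?_
  have h₁ : (a : EReal) * f p.1 ≤ a * p.2 :=
    mul_le_mul_of_nonneg_left hp (EReal.coe_nonneg.2 ha)
  have h₂ : (b : EReal) * f q.1 ≤ b * q.2 :=
    mul_le_mul_of_nonneg_left hq (EReal.coe_nonneg.2 hb)
  refine (add_le_add h₁ h₂).trans (le_of_eq ?_)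
  simp

lemma mem_affMinorants_of_separation {f : H → EReal} {u : H} {c r : ℝ} (hc : c < 0)
    (h : ∀ (a : H) (t : ℝ), f a ≤ t → ⟪a, u⟫ + c * t < r) :
    ((-c)⁻¹ • u, (-c)⁻¹ * r) ∈ affMinorants f := by
  intro a
  refine EReal.le_of_forall_lt_iff_le.1 fun t ht => EReal.coe_le_coe_iff.2 ?_
  have := h a t ht.le
  rw [inner_smul_right, ← mul_sub, inv_mul_le_iff₀ (by linarith)]
  linarith

variable [CompleteSpace H]

/-- Strict separation of the epigraph from a point below it. -/
lemma IsGamma0.exists_separation {f : H → EReal} (hf : IsGamma0 f) {x : H} {s : ℝ}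
    (hs : (s : EReal) < f x) :
    ∃ (u : H) (c r : ℝ), (∀ (a : H) (t : ℝ), f a ≤ t → ⟪a, u⟫ + c * t < r) ∧
      r < ⟪x, u⟫ + c * s := by
  obtain ⟨Λ, r, hΛ, hr⟩ := geometric_hahn_banach_closed_point hf.convex_realEpigraph
    hf.isClosed_realEpigraph (x := (x, s)) (not_le.2 hs)
  have key : ∀ (a : H) (t : ℝ), Λ (a, t) =
      ⟪a, (InnerProductSpace.toDual ℝ H).symm (Λ.comp (.inl ℝ H ℝ))⟫ + Λ (0, 1) * t := by
    intro a t
    rw [real_inner_comm, InnerProductSpace.toDual_symm_apply]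
    have : ((a, t) : H × ℝ) = (a, 0) + t • ((0, 1) : H × ℝ) := by simp
    rw [this, map_add, map_smul]
    simp [mul_comm]
  exact ⟨_, _, r, fun a t hat => key a t ▸ hΛ (a, t) hat, key x s ▸ hr⟩

/-- Every real number below `f x` is below the value at `x` of an affine minorant of `f`. -/
lemma IsGamma0.exists_affMinorant_gt {f : H → EReal} (hf : IsGamma0 f) {x : H} {s : ℝ}
    (hs : (s : EReal) < f x) : ∃ p ∈ affMinorants f, s < ⟪x, p.1⟫ - p.2 := by
  obtain ⟨x₀, hx₀⟩ := hf.1.2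
  obtain ⟨t₀, ht₀⟩ : ∃ t₀ : ℝ, f x₀ = t₀ :=
    ⟨_, (EReal.coe_toReal hx₀ (hf.1.1 x₀)).symm⟩
  have hbase : ∃ p, p ∈ affMinorants f := by
    obtain ⟨u, c, r, h, hr⟩ := hf.exists_separation (x := x₀) (s := t₀ - 1)
      (by rw [ht₀]; exact_mod_cast sub_one_lt t₀)
    have := h x₀ t₀ ht₀.le
    exact ⟨_, mem_affMinorants_of_separation (by linarith) h⟩
  obtain ⟨u, c, r, h, hr⟩ := hf.exists_separation hs
  rcases lt_trichotomy c 0 with hc | rfl | hc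
  · refine ⟨_, mem_affMinorants_of_separation hc h, ?_⟩
    rw [inner_smul_right, ← mul_sub, lt_inv_mul_iff₀ (by linarith)]
    linarith
  · obtain ⟨p, hp⟩ := hbase
    simp only [zero_mul, add_zero] at h hr
    obtain ⟨n, hn⟩ := exists_nat_gt ((s - (⟪x, p.1⟫ - p.2)) / (⟪x, u⟫ - r))
    rw [div_lt_iff₀ (by linarith)] at hn
    refine ⟨(p.1 + (n : ℝ) • u, p.2 + n * r), fun a => ?_, ?_⟩
    · refine EReal.le_of_forall_lt_iff_le.1 fun t ht => EReal.coe_le_coe_iff.2 ?_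
      have h₁ : ⟪a, p.1⟫ - p.2 ≤ t := by exact_mod_cast (hp a).trans ht.le
      have h₂ := mul_nonneg n.cast_nonneg (sub_nonneg.2 (h a t ht.le).le) (α := ℝ)
      rw [inner_add_right, inner_smul_right]
      linarith
    · rw [inner_add_right, inner_smul_right]
      linarith
  · have h' := h x₀ (max t₀ ((r - ⟪x₀, u⟫) / c)) (by
      rw [ht₀]; exact_mod_cast le_max_left _ _)
    have h₂ := mul_le_mul_of_nonneg_left (le_max_right t₀ ((r - ⟪x₀, u⟫) / c)) hc.le
    rw [mul_div_cancel₀ _ hc.ne'] at h₂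
    linarith

/-- A sequence that is pointwise bounded on a closed subspace `S` converges, along any ultrafilter,
weakly against `S`. -/
lemma exists_tendsto_inner_of_bounded (S : Submodule ℝ H) (hS : IsClosed (S : Set H))
    (x : ℕ → H) (hx : ∀ w ∈ S, ∃ C, ∀ n, |⟪x n, w⟫| ≤ C) (U : Ultrafilter ℕ) :
    ∃ z : H, ∀ w ∈ S, Filter.Tendsto (fun n => ⟪x n, w⟫) U (nhds ⟪z, w⟫) := by
  have : CompleteSpace S := hS.completeSpace_coe
  let φ : ℕ → StrongDual ℝ S := fun n => (innerSL ℝ (x n)).comp S.subtypeL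
  obtain ⟨C, hC⟩ : ∃ C, ∀ n, ‖φ n‖ ≤ C := banach_steinhaus fun w => hx w w.2
  obtain ⟨ψ, -, hψ⟩ := isCompact_iff_ultrafilter_le_nhds.1
    (WeakDual.isCompact_closedBall (𝕜 := ℝ) (E := S) 0 C)
    (U.map fun n => StrongDual.toWeakDual (φ n)) (by
      simp only [Filter.le_principal_iff, Ultrafilter.mem_coe, Ultrafilter.mem_map]
      exact Filter.univ_mem' fun n => by simpa using hC n)
  refine ⟨((InnerProductSpace.toDual ℝ S).symm (WeakDual.toStrongDual ψ) : S), fun w hw => ?_⟩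
  have hev := ((WeakDual.eval_continuous (𝕜 := ℝ) (⟨w, hw⟩ : S)).tendsto ψ).comp hψ
  have hval : ⟪(((InnerProductSpace.toDual ℝ S).symm (WeakDual.toStrongDual ψ) : S) : H), w⟫ =
      ψ ⟨w, hw⟩ :=
    InnerProductSpace.toDual_symm_apply (𝕜 := ℝ) (E := S) (x := ⟨w, hw⟩)
      (y := WeakDual.toStrongDual ψ)
  rw [hval]
  exact hev

end Minorants

section InfConvInfPost

variable {H G : Type*} [NormedAddCommGroup H] [InnerProductSpace ℝ H]
  [NormedAddCommGroup G] [InnerProductSpace ℝ G]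

lemma infConv_infPost_le (f : H → EReal) (g : G → EReal) (L : H →L[ℝ] G) (x : H) (y : G) :
    infConv (infPost L f) g y ≤ f x + g (y - L x) := by
  refine (iInf_le _ (y - L x)).trans (add_le_add ?_ le_rfl)
  exact iInf_le (fun z : {z : H // L z = y - (y - L x)} => f z.1) ⟨x, by simp⟩

lemma exists_lt_of_infConv_infPost_lt {f : H → EReal} {g : G → EReal} {L : H →L[ℝ] G}
    (hL : ∀ y, infPost L f y ≠ ⊥) (hg : ∀ y, g y ≠ ⊥) {y : G} {α : EReal}
    (h : infConv (infPost L f) g y < α) : ∃ x, f x + g (y - L x) < α := by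
  obtain ⟨z, hz⟩ := iInf_lt_iff.1 h
  have hgz : g z ≠ ⊤ := fun h' => by
    rw [h', EReal.add_top_of_ne_bot (hL _)] at hz
    exact not_top_lt hz
  have hz' : infPost L f (y - z) < α - g z :=
    (EReal.lt_sub_iff_add_lt (.inl (hg z)) (.inl hgz)).2 hz
  obtain ⟨⟨x, hx⟩, hxz⟩ := iInf_lt_iff.1 hz'
  refine ⟨x, ?_⟩
  rw [hx, sub_sub_cancel]
  exact EReal.add_lt_of_lt_sub hxz

variable [CompleteSpace H] [CompleteSpace G]

/-- The value `f x + g z` is determined by the affine minorants of `f` and `g`. -/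
lemma IsGamma0.add_le_iff_forall_affMinorants {f : H → EReal} {g : G → EReal}
    (hf : IsGamma0 f) (hg : IsGamma0 g) {x : H} {z : G} {α : ℝ} :
    f x + g z ≤ α ↔ ∀ p ∈ affMinorants f, ∀ q ∈ affMinorants g,
      (⟪x, p.1⟫ - p.2) + (⟪z, q.1⟫ - q.2) ≤ α := by
  refine ⟨fun h p hp q hq => ?_, fun h => ?_⟩
  · exact_mod_cast (add_le_add (hp x) (hq z)).trans h
  · refine EReal.add_le_of_forall_lt fun a ha b hb => ?_
    obtain ⟨s, has, hs⟩ := EReal.lt_iff_exists_real_btwn.1 ha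
    obtain ⟨t, hbt, ht⟩ := EReal.lt_iff_exists_real_btwn.1 hb
    obtain ⟨p, hp, hsp⟩ := hf.exists_affMinorant_gt hs
    obtain ⟨q, hq, htq⟩ := hg.exists_affMinorant_gt ht
    refine (add_le_add has.le hbt.le).trans ?_
    have := h p hp q hq
    exact_mod_cast (by linarith : s + t ≤ α)

end InfConvInfPost

/-- under the qualification `0 ∈ sri(L*(dom g*) − dom f*)`,
`(L ▷ f) □ g ∈ Γ₀(G)`. -/
theorem isGamma0_infConv_infPost {H G : Type*}
    [NormedAddCommGroup H] [InnerProductSpace ℝ H] [CompleteSpace H]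
    [NormedAddCommGroup G] [InnerProductSpace ℝ G] [CompleteSpace G]
    (f : H → EReal) (g : G → EReal) (L : H →L[ℝ] G)
    (hf : IsGamma0 f) (hg : IsGamma0 g)
    (hq : sriMem (ContinuousLinearMap.adjoint L '' effDom (fconj g) - effDom (fconj f)) 0) :
    IsGamma0 (infConv (infPost L f) g) := by
  have hiff := fun x z α => hf.add_le_iff_forall_affMinorants hg (x := x) (z := z) (α := α)
  obtain ⟨h0, S, hSclosed, hS⟩ := hq
  simp only [sub_zero, Set.image_id'] at hS
  obtain ⟨_, ⟨v₀, hv₀, rfl⟩, u₀, hu₀, huv⟩ := h0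
  obtain rfl : ContinuousLinearMap.adjoint L v₀ = u₀ := sub_eq_zero.1 huv
  obtain ⟨c₀, hc₀⟩ := exists_mem_affMinorants_of_mem_effDom_fconj hf.1 hu₀
  obtain ⟨d₀, hd₀⟩ := exists_mem_affMinorants_of_mem_effDom_fconj hg.1 hv₀
  have hLbot : ∀ y, infPost L f y ≠ ⊥ := by
    intro y
    have : ((⟪y, v₀⟫ - c₀ : ℝ) : EReal) ≤ infPost L f y := by
      refine le_iInf fun ⟨x, hx⟩ => ?_
      have := hc₀ x
      rwa [ContinuousLinearMap.adjoint_inner_right, hx] at this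
    exact ((EReal.bot_lt_coe _).trans_le this).ne'
  have hlt : ∀ {y : G} {α : ℝ}, infConv (infPost L f) g y < α →
      ∃ x, f x + g (y - L x) ≤ α := fun h =>
    (exists_lt_of_infConv_infPost_lt hLbot hg.1.1 h).imp fun _ hx => hx.le
  have hbot : ∀ y, infConv (infPost L f) g y ≠ ⊥ := by
    intro y
    have : ((⟪y, v₀⟫ - c₀ - d₀ : ℝ) : EReal) ≤ infConv (infPost L f) g y := by
      refine EReal.le_of_forall_lt_iff_le.1 fun t ht => EReal.coe_le_coe_iff.2 ?_
      obtain ⟨x, hx⟩ := hlt ht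
      have := (hiff _ _ _).1 hx _ hc₀ _ hd₀
      simp only [ContinuousLinearMap.adjoint_inner_right, inner_sub_left] at this
      linarith
    exact ((EReal.bot_lt_coe _).trans_le this).ne'
  refine ⟨⟨hbot, ?_⟩, ?_, ?_⟩
  · obtain ⟨x, hx⟩ := hf.1.2
    obtain ⟨z, hz⟩ := hg.1.2
    refine ⟨L x + z, ((infConv_infPost_le f g L x (L x + z)).trans_lt ?_).ne⟩
    rw [add_sub_cancel_left]
    exact EReal.add_lt_top hx hz
  · intro y₁ y₂ a b ha hb hab
    rcases ha.eq_or_lt with rfl | ha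
    · obtain rfl : b = 1 := by linarith
      simp
    rcases hb.eq_or_lt with rfl | hb
    · obtain rfl : a = 1 := by linarith
      simp
    induction h₁ : infConv (infPost L f) g y₁ using EReal.rec with
    | bot => exact absurd h₁ (hbot _)
    | top =>
      rw [EReal.coe_mul_top_of_pos ha, EReal.top_add_of_ne_bot]
      · exact le_top
      · rw [EReal.mul_ne_bot]
        simp [hbot, hb.le]
    | coe r₁ =>
    induction h₂ : infConv (infPost L f) g y₂ using EReal.rec with
    | bot => exact absurd h₂ (hbot _)
    | top =>
      rw [EReal.coe_mul_top_of_pos hb, ← EReal.coe_mul, EReal.coe_add_top]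
      exact le_top
    | coe r₂ =>
    refine EReal.le_of_forall_lt_iff_le.1 fun t ht => ?_
    have ht' : a * r₁ + b * r₂ < t := by exact_mod_cast ht
    set ε := t - (a * r₁ + b * r₂) with hε
    obtain ⟨x₁, hx₁⟩ := hlt (y := y₁) (α := r₁ + ε) (by
      rw [h₁]; exact_mod_cast (by linarith : r₁ < r₁ + ε))
    obtain ⟨x₂, hx₂⟩ := hlt (y := y₂) (α := r₂ + ε) (by
      rw [h₂]; exact_mod_cast (by linarith : r₂ < r₂ + ε))
    refine (infConv_infPost_le f g L (a • x₁ + b • x₂) _).trans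
      ((hiff _ _ _).2 fun p hp q hq => ?_)
    have e₁ := mul_le_mul_of_nonneg_left ((hiff _ _ _).1 hx₁ p hp q hq) ha.le
    have e₂ := mul_le_mul_of_nonneg_left ((hiff _ _ _).1 hx₂ p hp q hq) hb.le
    obtain rfl : b = 1 - a := by linarith
    simp only [map_add, map_smul, inner_add_left, inner_sub_left, real_inner_smul_left] at e₁ e₂ ⊢
    linarith
  · rw [lowerSemicontinuous_iff_isClosed_preimage]
    intro β
    refine isSeqClosed_iff_isClosed.1 fun y y' hy hyy' => ?_
    refine EReal.le_of_forall_lt_iff_le.1 fun α hα => ?_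
    choose x hx using fun n => hlt ((hy n).trans_lt hα)
    simp only [hiff, inner_sub_left, ← ContinuousLinearMap.adjoint_inner_right] at hx
    have hyv : ∀ v, Filter.Tendsto (fun n => ⟪y n, v⟫) Filter.atTop (nhds ⟪y', v⟫) :=
      fun v => hyy'.inner tendsto_const_nhds
    have hbdd : ∀ w ∈ S, ∃ C, ∀ n, -C ≤ ⟪x n, w⟫ := by
      intro w hw
      rw [← SetLike.mem_coe, ← hS] at hw
      obtain ⟨c, hc, _, ⟨_, ⟨v, hv, rfl⟩, u, hu, rfl⟩, rfl⟩ := hw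
      obtain ⟨s, hs⟩ := exists_mem_affMinorants_of_mem_effDom_fconj hf.1 hu
      obtain ⟨t, ht⟩ := exists_mem_affMinorants_of_mem_effDom_fconj hg.1 hv
      obtain ⟨B, hB⟩ := (hyv v).bddBelow_range
      refine ⟨c * (α + s + t - B), fun n => ?_⟩
      have h₁ : B ≤ ⟪y n, v⟫ := hB ⟨n, rfl⟩
      have h₂ := hx n _ hs _ ht
      simp only [inner_smul_right, inner_sub_right]
      rw [← mul_neg]
      exact mul_le_mul_of_nonneg_left (by linarith) hc
    obtain ⟨z, hz⟩ := exists_tendsto_inner_of_bounded S hSclosed x (fun w hw => by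
      obtain ⟨C, hC⟩ := hbdd w hw
      obtain ⟨D, hD⟩ := hbdd (-w) (S.neg_mem hw)
      refine ⟨max C D, fun n => abs_le.2 ?_⟩
      have h₁ := hC n
      have h₂ := hD n
      rw [inner_neg_right] at h₂
      constructor <;> linarith [le_max_left C D, le_max_right C D])
      (Ultrafilter.of Filter.atTop)
    refine (infConv_infPost_le f g L z y').trans ((hiff _ _ _).2 fun p hp q hq => ?_)
    have hw : ContinuousLinearMap.adjoint L q.1 - p.1 ∈ S := by
      rw [← SetLike.mem_coe, ← hS]
      exact ⟨1, zero_le_one, _, Set.sub_mem_sub (Set.mem_image_of_mem _ (fst_mem_effDom_fconj hq))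
        (fst_mem_effDom_fconj hp), (one_smul _ _).symm⟩
    have hlim := ((hyv q.1).mono_left (Ultrafilter.of_le _)).sub (hz _ hw)
    have := le_of_tendsto hlim (b := α + p.2 + q.2) (Filter.Eventually.of_forall fun n => by
      have := hx n p hp q hq
      rw [inner_sub_right]
      linarith)
    rw [inner_sub_right, ContinuousLinearMap.adjoint_inner_right] at this
    rw [inner_sub_left]
    linarith
end
end

section
/- Let H, G be real Hilbert spaces, let A : H → 2^H and B : G → 2^G be maximally monotone, and let L : H → G be bounded linear. Suppose the cone generated by L*(ran B) − ran A is a closed vector subspace. Then (L ▷ A) □ B is maximally monotone. -/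
open scoped Pointwise RealInnerProductSpace

noncomputable section

open Filter Topology

theorem isMaxMonotoneOp_iff {E : Type*} [NormedAddCommGroup E] [InnerProductSpace ℝ E]
    {A : E → Set E} :
    IsMaxMonotoneOp A ↔ IsMonotoneOp A ∧
      ∀ x u, (∀ y e, e ∈ A y → (0 : ℝ) ≤ ⟪x - y, u - e⟫) → u ∈ A x := by
  constructor
  · rintro ⟨hm, hmax⟩
    refine ⟨hm, fun x u h => ?_⟩
    have hB := hmax (fun z => A z ∪ {e | z = x ∧ e = u}) ?_ (fun z => Set.subset_union_left)
    · have : u ∈ (fun z => A z ∪ {e | z = x ∧ e = u}) x := Or.inr ⟨rfl, rfl⟩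
      rwa [hB] at this
    · rintro a b p q (hp | ⟨rfl, rfl⟩) (hq | ⟨rfl, rfl⟩)
      · exact hm _ _ _ _ hp hq
      · have := h a p hp
        rwa [← neg_sub a, ← neg_sub p, inner_neg_neg] at this
      · exact h _ _ hq
      · simp
  · rintro ⟨hm, hmax⟩
    refine ⟨hm, fun B hB hAB => funext fun x => Set.Subset.antisymm (fun u hu => ?_) (hAB x)⟩
    exact hmax x u fun y e he => hB _ _ _ _ hu (hAB y he)

theorem svRan_eq_setOf_svInv_nonempty {α β : Type*} (A : α → Set β) :
    SVRan A = {u | (SVInv A u).Nonempty} :=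
  Set.ext fun _ => Set.mem_iUnion

theorem IsMaxMonotoneOp.svInv {E : Type*} [NormedAddCommGroup E] [InnerProductSpace ℝ E]
    {A : E → Set E} (hA : IsMaxMonotoneOp A) : IsMaxMonotoneOp (SVInv A) := by
  rw [isMaxMonotoneOp_iff] at hA ⊢
  refine ⟨fun x y u v hu hv => ?_, fun x u h => hA.2 u x fun y e he => ?_⟩
  · rw [real_inner_comm]
    exact hA.1 _ _ _ _ hu hv
  · rw [real_inner_comm]
    exact h e y he

theorem exists_affine_minorant_of_bddBelow {X : Type*} [NormedAddCommGroup X]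
    [InnerProductSpace ℝ X] [CompleteSpace X] {K : Set (X × ℝ)} (hne : K.Nonempty)
    (hcl : IsClosed K) (hconv : Convex ℝ K) (hb : ∀ p ∈ K, 0 ≤ p.2 + ‖p.1‖ ^ 2 / 2) :
    ∃ p ∈ K, ∀ q ∈ K, p.2 + ‖p.1‖ ^ 2 ≤ q.2 + ⟪p.1, q.1⟫ := by
  set φ : X × ℝ → ℝ := fun p => p.2 + ‖p.1‖ ^ 2 / 2 with hφ
  have hbdd : BddBelow (φ '' K) := ⟨0, by rintro _ ⟨p, hp, rfl⟩; exact hb p hp⟩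
  set m := sInf (φ '' K) with hm
  have hmle : ∀ p ∈ K, m ≤ φ p := fun p hp => csInf_le hbdd ⟨p, hp, rfl⟩
  have happ : ∀ n : ℕ, ∃ p ∈ K, φ p < m + 1 / ((n : ℝ) + 1) := fun n => by
    obtain ⟨_, ⟨p, hp, rfl⟩, h⟩ := exists_lt_of_csInf_lt (hne.image φ)
      (lt_add_of_pos_right m (Nat.one_div_pos_of_nat (α := ℝ) (n := n)))
    exact ⟨p, hp, h⟩
  choose p hpK hp using happ
  have hlim := tendsto_one_div_add_atTop_nhds_zero_nat (𝕜 := ℝ)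
  have hsq : ∀ i j, ‖(p i).1 - (p j).1‖ ^ 2 ≤ 4 * (1 / ((i : ℝ) + 1) + 1 / ((j : ℝ) + 1)) := by
    intro i j
    have h1 := hmle _ (hconv (hpK i) (hpK j) (a := 1 / 2) (b := 1 / 2) (by norm_num) (by norm_num)
      (by norm_num))
    have h2 := hp i
    have h3 := hp j
    simp only [hφ, Prod.fst_add, Prod.snd_add, Prod.smul_fst, Prod.smul_snd, smul_eq_mul,
      ← smul_add, norm_smul, mul_pow] at h1 h2 h3
    have h4 := parallelogram_law_with_norm ℝ (p i).1 (p j).1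
    norm_num at h1
    nlinarith
  have hcauchy : CauchySeq fun n => (p n).1 := by
    rw [Metric.cauchySeq_iff']
    intro ε hε
    obtain ⟨N, hN⟩ := exists_nat_one_div_lt (show (0 : ℝ) < ε ^ 2 / 8 by positivity)
    refine ⟨N, fun n hn => ?_⟩
    rw [dist_eq_norm]
    have h1 := hsq n N
    have h2 : 1 / ((n : ℝ) + 1) ≤ 1 / ((N : ℝ) + 1) := Nat.one_div_le_one_div hn
    exact lt_of_pow_lt_pow_left₀ 2 hε.le (by linarith)
  obtain ⟨x, hx⟩ := cauchySeq_tendsto_of_complete hcauchy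
  have hφlim : Tendsto (fun n => φ (p n)) atTop (𝓝 m) :=
    tendsto_of_tendsto_of_tendsto_of_le_of_le tendsto_const_nhds
      (by simpa using hlim.const_add m) (fun n => hmle _ (hpK n)) fun n => (hp n).le
  have hr : Tendsto (fun n => (p n).2) atTop (𝓝 (m - ‖x‖ ^ 2 / 2)) := by
    refine (hφlim.sub ((hx.norm.pow 2).div_const 2)).congr fun n => ?_
    simp [hφ]
  have hxK : (x, m - ‖x‖ ^ 2 / 2) ∈ K :=
    hcl.mem_of_tendsto (hx.prodMk_nhds hr) (Eventually.of_forall hpK)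
  refine ⟨_, hxK, fun q hq => ?_⟩
  have key : ∀ t : ℝ, 0 < t → t ≤ 1 →
      0 ≤ q.2 - (m - ‖x‖ ^ 2 / 2) + ⟪x, q.1 - x⟫ + t * (‖q.1 - x‖ ^ 2 / 2) := by
    intro t ht ht1
    have h1 := hmle _ (hconv hxK hq (a := 1 - t) (b := t) (by linarith) ht.le (by ring))
    have h2 : (1 - t) • x + t • q.1 = x + t • (q.1 - x) := by module
    simp only [hφ, Prod.fst_add, Prod.snd_add, Prod.smul_fst, Prod.smul_snd, smul_eq_mul, h2] at h1
    rw [norm_add_sq_real, inner_smul_right, norm_smul, mul_pow, Real.norm_eq_abs, sq_abs] at h1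
    refine nonneg_of_mul_nonneg_right (a := t) ?_ ht
    nlinarith
  have hlim0 : Tendsto (fun n : ℕ => q.2 - (m - ‖x‖ ^ 2 / 2) + ⟪x, q.1 - x⟫ +
      1 / ((n : ℝ) + 1) * (‖q.1 - x‖ ^ 2 / 2)) atTop
      (𝓝 (q.2 - (m - ‖x‖ ^ 2 / 2) + ⟪x, q.1 - x⟫)) := by
    simpa using (hlim.mul_const (‖q.1 - x‖ ^ 2 / 2)).const_add
      (q.2 - (m - ‖x‖ ^ 2 / 2) + ⟪x, q.1 - x⟫)
  have h0 := ge_of_tendsto' hlim0 fun n => key _ Nat.one_div_pos_of_nat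
    (by rw [div_le_one (by positivity)]; linarith [(Nat.cast_nonneg n : (0 : ℝ) ≤ n)])
  rw [inner_sub_right, real_inner_self_eq_norm_sq] at h0
  simp only
  linarith

theorem IsMaxMonotoneOp.exists_neg_mem {E : Type*} [NormedAddCommGroup E]
    [InnerProductSpace ℝ E] [CompleteSpace E] {A : E → Set E} (hA : IsMaxMonotoneOp A) :
    ∃ x, -x ∈ A x := by
  rw [isMaxMonotoneOp_iff] at hA
  obtain ⟨hmono, hmax⟩ := hA
  set S : Set (WithLp 2 (E × E) × ℝ) :=
    {p | p.1.snd ∈ A p.1.fst ∧ p.2 = ⟪p.1.fst, p.1.snd⟫} with hS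
  have hSne : S.Nonempty := by
    by_contra hempty
    have h0 : (0 : E) ∈ A 0 := hmax 0 0 fun y e he =>
      absurd ⟨(WithLp.toLp 2 (y, e), ⟪y, e⟫), he, rfl⟩ hempty
    exact hempty ⟨(WithLp.toLp 2 (0, 0), ⟪(0 : E), 0⟫), h0, rfl⟩
  set F : Set (WithLp 2 (E × E) × ℝ) :=
    {p | ∀ y e, e ∈ A y → ⟪p.1.fst, e⟫ + ⟪y, p.1.snd⟫ - ⟪y, e⟫ ≤ p.2} with hF
  have hSF : S ⊆ F := by
    rintro ⟨p, r⟩ ⟨hp, hr⟩ y e he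
    have := hmono _ _ _ _ hp he
    simp only at hr ⊢
    rw [inner_sub_left, inner_sub_right, inner_sub_right] at this
    linarith
  have hFconv : Convex ℝ F := by
    intro p hp q hq a b ha hb hab y e he
    have h1 := mul_le_mul_of_nonneg_left (hp y e he) ha
    have h2 := mul_le_mul_of_nonneg_left (hq y e he) hb
    simp only [Prod.fst_add, Prod.snd_add, Prod.smul_fst, Prod.smul_snd, WithLp.add_fst,
      WithLp.add_snd, WithLp.smul_fst, WithLp.smul_snd, inner_add_left, inner_add_right,
      real_inner_smul_left, real_inner_smul_right, smul_eq_mul]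
    have h3 : ⟪y, e⟫ = a * ⟪y, e⟫ + b * ⟪y, e⟫ := by rw [← add_mul, hab, one_mul]
    linarith
  have hFcl : IsClosed F := by
    simp only [hF, Set.ofPred_forall]
    refine isClosed_iInter fun y => isClosed_iInter fun e => isClosed_iInter fun _ => ?_
    exact isClosed_le (by fun_prop) (by fun_prop)
  have hFge : ∀ p ∈ F, ⟪p.1.fst, p.1.snd⟫ ≤ p.2 := by
    intro p hp
    by_contra! hlt
    have hmem : p.1.snd ∈ A p.1.fst := hmax _ _ fun y e he => by
      have := hp y e he
      rw [inner_sub_left, inner_sub_right, inner_sub_right]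
      linarith
    have := hp _ _ hmem
    linarith
  have hKF : closure (convexHull ℝ S) ⊆ F := closure_minimal (convexHull_min hSF hFconv) hFcl
  obtain ⟨⟨p, r⟩, hpK, hp⟩ := exists_affine_minorant_of_bddBelow
    (hSne.mono ((subset_convexHull ℝ S).trans subset_closure)) isClosed_closure
    (convex_convexHull ℝ S).closure (fun q hq => by
      have h1 := hFge q (hKF hq)
      have h2 := norm_add_sq_real q.1.fst q.1.snd
      rw [WithLp.prod_norm_sq_eq_of_L2]
      nlinarith [sq_nonneg ‖q.1.fst + q.1.snd‖])
  have hr := hFge _ (hKF hpK)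
  have key : ∀ y e, e ∈ A y → ‖p.fst + p.snd‖ ^ 2 ≤ ⟪y + p.snd, e + p.fst⟫ := by
    intro y e he
    have h1 := hp (WithLp.toLp 2 (y, e), ⟪y, e⟫)
      (subset_closure (subset_convexHull ℝ S ⟨he, rfl⟩))
    simp only [WithLp.prod_norm_sq_eq_of_L2, WithLp.prod_inner_apply] at h1 hr
    change _ ≤ ⟪y, e⟫ + (⟪p.fst, y⟫ + ⟪p.snd, e⟫) at h1
    rw [norm_add_sq_real, inner_add_left, inner_add_right, inner_add_right, real_inner_comm p.fst y,
      real_inner_comm p.fst p.snd]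
    linarith
  have hmem : -p.fst ∈ A (-p.snd) := hmax _ _ fun y e he => by
    have := (sq_nonneg _).trans (key y e he)
    rwa [← inner_neg_neg, neg_sub, neg_sub, sub_neg_eq_add, sub_neg_eq_add]
  have h0 := key _ _ hmem
  have hsum : p.fst + p.snd = 0 := by
    rw [← norm_eq_zero]
    simp only [neg_add_cancel, inner_zero_left] at h0
    exact pow_eq_zero_iff two_ne_zero |>.1 (le_antisymm h0 (sq_nonneg _))
  refine ⟨p.fst, ?_⟩
  rwa [neg_eq_of_add_eq_zero_left hsum] at hmem

theorem IsMaxMonotoneOp.exists_sub_mem {E : Type*} [NormedAddCommGroup E]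
    [InnerProductSpace ℝ E] [CompleteSpace E] {A : E → Set E} (hA : IsMaxMonotoneOp A) (w : E) :
    ∃ x, w - x ∈ A x := by
  have hshift : IsMaxMonotoneOp fun x => {u | w + u ∈ A x} := by
    rw [isMaxMonotoneOp_iff] at hA ⊢
    refine ⟨fun x y u v hu hv => ?_, fun x u h => hA.2 _ _ fun y e he => ?_⟩
    · simpa using hA.1 _ _ _ _ hu hv
    · have := h y (e - w) (by simpa using he)
      rwa [show u - (e - w) = w + u - e by abel] at this
  obtain ⟨x, hx⟩ := hshift.exists_neg_mem
  exact ⟨x, by simpa [sub_eq_add_neg] using hx⟩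

theorem IsMonotoneOp.isMaxMonotoneOp_of_exists_sub_mem {E : Type*} [NormedAddCommGroup E]
    [InnerProductSpace ℝ E] {A : E → Set E} (hA : IsMonotoneOp A)
    (hsurj : ∀ w, ∃ x, w - x ∈ A x) : IsMaxMonotoneOp A := by
  refine isMaxMonotoneOp_iff.2 ⟨hA, fun x u h => ?_⟩
  obtain ⟨v, hv⟩ := hsurj (x + u)
  have h0 := h _ _ hv
  rw [show u - (x + u - v) = -(x - v) by abel, inner_neg_right, real_inner_self_eq_norm_sq] at h0
  have hxv : x = v := by
    rw [← sub_eq_zero, ← norm_eq_zero]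
    exact pow_eq_zero_iff two_ne_zero |>.1 (by nlinarith [sq_nonneg ‖x - v‖])
  simpa [← hxv] using hv

theorem exists_weak_limit_of_bounded {ι E : Type*} [NormedAddCommGroup E]
    [InnerProductSpace ℝ E] [CompleteSpace E] {c : ι → E} {K : ℝ} (hc : ∀ i, ‖c i‖ ≤ K)
    (l : Ultrafilter ι) : ∃ c₀ : E, ∀ h : E, Tendsto (fun i => ⟪c i, h⟫) l (𝓝 ⟪c₀, h⟫) := by
  set f : ι → WeakDual ℝ E :=
    fun i => StrongDual.toWeakDual (InnerProductSpace.toDual ℝ E (c i)) with hf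
  obtain ⟨g, -, hg⟩ := (WeakDual.isCompact_closedBall (𝕜 := ℝ) (E := E) 0 K).ultrafilter_le_nhds
    (l.map f) (by
      rw [Ultrafilter.coe_map, le_principal_iff, mem_map]
      refine Eventually.of_forall fun i => ?_
      simpa [hf] using hc i)
  refine ⟨(InnerProductSpace.toDual ℝ E).symm (WeakDual.toStrongDual g), fun h => ?_⟩
  have := ((WeakDual.eval_continuous h).tendsto g).comp hg
  simpa [hf, Function.comp_def] using this

theorem tendsto_inner_of_tendsto_of_weak {ι E : Type*} [NormedAddCommGroup E]
    [InnerProductSpace ℝ E] {l : Filter ι} {x c : ι → E} {x₀ c₀ : E} {K : ℝ}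
    (hx : Tendsto x l (𝓝 x₀)) (hK : ∀ i, ‖c i‖ ≤ K)
    (hc : ∀ h : E, Tendsto (fun i => ⟪c i, h⟫) l (𝓝 ⟪c₀, h⟫)) :
    Tendsto (fun i => ⟪x i, c i⟫) l (𝓝 ⟪x₀, c₀⟫) := by
  have h1 : Tendsto (fun i => ⟪x i - x₀, c i⟫) l (𝓝 0) := by
    refine squeeze_zero_norm (a := fun i => ‖x i - x₀‖ * K) (fun i => ?_) ?_
    · exact (norm_inner_le_norm _ _).trans (mul_le_mul_of_nonneg_left (hK i) (norm_nonneg _))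
    · simpa using (tendsto_iff_norm_sub_tendsto_zero.1 hx).mul_const K
  have h2 := h1.add (hc x₀)
  rw [zero_add, real_inner_comm] at h2
  refine h2.congr fun i => ?_
  rw [inner_sub_left, real_inner_comm x₀ (c i), sub_add_cancel]

theorem IsMaxMonotoneOp.mem_of_tendsto_of_weak {ι E : Type*} [NormedAddCommGroup E]
    [InnerProductSpace ℝ E] {A : E → Set E} (hA : IsMaxMonotoneOp A) {l : Filter ι} [l.NeBot]
    {x c : ι → E} {x₀ c₀ : E} {K : ℝ} (hmem : ∀ i, c i ∈ A (x i))
    (hx : Tendsto x l (𝓝 x₀)) (hK : ∀ i, ‖c i‖ ≤ K)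
    (hc : ∀ h : E, Tendsto (fun i => ⟪c i, h⟫) l (𝓝 ⟪c₀, h⟫)) : c₀ ∈ A x₀ := by
  rw [isMaxMonotoneOp_iff] at hA
  refine hA.2 _ _ fun y e he => ?_
  have hlim : Tendsto (fun i => ⟪x i - y, c i - e⟫) l (𝓝 ⟪x₀ - y, c₀ - e⟫) := by
    refine tendsto_inner_of_tendsto_of_weak (K := K + ‖e‖) (hx.sub_const y)
      (fun i => (norm_sub_le _ _).trans (by linarith [hK i])) fun h => ?_
    simpa only [inner_sub_left] using (hc h).sub_const ⟪e, h⟫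
  exact ge_of_tendsto' hlim fun i => hA.1 _ _ _ _ (hmem i) he

theorem exists_norm_le_of_forall_bddBelow_inner {ι E : Type*} [NormedAddCommGroup E]
    [InnerProductSpace ℝ E] (S : Submodule ℝ E) [CompleteSpace S] {c : ι → E}
    (hcS : ∀ i, c i ∈ S) (hb : ∀ s ∈ S, ∃ K, ∀ i, -K ≤ ⟪c i, s⟫) : ∃ K, ∀ i, ‖c i‖ ≤ K := by
  obtain ⟨K, hK⟩ := banach_steinhaus (g := fun i => innerSL ℝ (⟨c i, hcS i⟩ : S)) (fun s => by
    obtain ⟨K₁, h₁⟩ := hb s s.2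
    obtain ⟨K₂, h₂⟩ := hb (-s) (-s).2
    refine ⟨max K₁ K₂, fun i => ?_⟩
    have h3 := h₂ i
    rw [inner_neg_right] at h3
    rw [innerSL_apply_apply, Submodule.coe_inner, Real.norm_eq_abs, abs_le]
    exact ⟨by linarith [h₁ i, le_max_left K₁ K₂], by linarith [le_max_right K₁ K₂]⟩)
  exact ⟨K, fun i => by simpa using hK i⟩

theorem IsMaxMonotoneOp.mem_and_mem_of_forall_inner_add {H G : Type*} [NormedAddCommGroup H]
    [InnerProductSpace ℝ H] [NormedAddCommGroup G] [InnerProductSpace ℝ G] {C : H → Set H} {D : G → Set G}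
    (hC : IsMaxMonotoneOp C) (hD : IsMaxMonotoneOp D) {x c : H} {v d : G}
    (h : ∀ y e, e ∈ C y → ∀ a b, b ∈ D a → (0 : ℝ) ≤ ⟪x - y, c - e⟫ + ⟪v - a, d - b⟫) :
    c ∈ C x ∧ d ∈ D v := by
  rw [isMaxMonotoneOp_iff] at hC hD
  have hc : c ∈ C x := by
    by_contra hc
    have hd : d ∈ D v := by
      refine hD.2 _ _ fun a b hab => ?_
      by_contra! hlt
      exact hc (hC.2 _ _ fun y e he => by linarith [h y e he a b hab])
    exact hc (hC.2 _ _ fun y e he => by simpa using h y e he v d hd)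
  exact ⟨hc, hD.2 _ _ fun a b hab => by simpa using h x c hc a b hab⟩

section SumRule

variable {H G : Type*} [NormedAddCommGroup H] [InnerProductSpace ℝ H] [CompleteSpace H]
  [NormedAddCommGroup G] [InnerProductSpace ℝ G] [CompleteSpace G]

/-- Solvability of the inclusion `w ∈ v + L (C_λ (L* v)) + D v` with `λ = ε ^ 2`, where `C_λ` is
the Yosida approximation of `C`. -/
theorem IsMaxMonotoneOp.exists_regularized_solution {C : H → Set H} {D : G → Set G}
    (hC : IsMaxMonotoneOp C) (hD : IsMaxMonotoneOp D) (L : H →L[ℝ] G) {ε : ℝ} (hε : 0 < ε)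
    (w : G) :
    ∃ v c, c ∈ C (ContinuousLinearMap.adjoint L v - ε ^ 2 • c) ∧ w - v - L c ∈ D v := by
  set M := ContinuousLinearMap.adjoint L with hM
  have hML : ∀ (v : G) (c : H), ⟪v, L c⟫ = ⟪M v, c⟫ := fun v c =>
    (ContinuousLinearMap.adjoint_inner_left L c v).symm
  have hcalc : ∀ (v a g k : G) (s t h j : H),
      ⟪(M v - ε • s) - (M a - ε • t), -(ε⁻¹ • h) - -(ε⁻¹ • j)⟫ +
        ⟪v - a, (g + L (ε⁻¹ • h)) - (k + L (ε⁻¹ • j))⟫ = ⟪v - a, g - k⟫ + ⟪s - t, h - j⟫ := by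
    intro v a g k s t h j
    have e1 : (M v - ε • s) - (M a - ε • t) = M (v - a) - ε • (s - t) := by
      rw [map_sub]; module
    have e2 : -(ε⁻¹ • h) - -(ε⁻¹ • j) = -(ε⁻¹ • (h - j)) := by module
    have e3 : (g + L (ε⁻¹ • h)) - (k + L (ε⁻¹ • j)) = (g - k) + L (ε⁻¹ • (h - j)) := by
      rw [smul_sub, map_sub]; abel
    rw [e1, e2, e3, inner_add_right, hML, inner_neg_right, inner_sub_left, real_inner_smul_left,
      real_inner_smul_right (s - t), mul_inv_cancel_left₀ hε.ne']
    ring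
  have hT : IsMaxMonotoneOp fun p : WithLp 2 (G × H) => {q : WithLp 2 (G × H) |
      -(ε⁻¹ • q.snd) ∈ C (M p.fst - ε • p.snd) ∧ q.fst + L (ε⁻¹ • q.snd) ∈ D p.fst} := by
    refine isMaxMonotoneOp_iff.2 ⟨fun p p' q q' hq hq' => ?_, fun p q h => ?_⟩
    · rw [WithLp.prod_inner_apply]
      exact (add_nonneg (hC.1 _ _ _ _ hq.1 hq'.1) (hD.1 _ _ _ _ hq.2 hq'.2)).trans_eq
        (hcalc _ _ _ _ _ _ _ _)
    · refine hC.mem_and_mem_of_forall_inner_add hD fun y e he a b hab => ?_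
      have ht : M a - ε • (ε⁻¹ • (M a - y)) = y := by
        rw [smul_inv_smul₀ hε.ne', sub_sub_cancel]
      have hj : -(ε⁻¹ • (-(ε • e))) = e := by
        rw [smul_neg, inv_smul_smul₀ hε.ne', neg_neg]
      have hk : (b + L e) + L (ε⁻¹ • (-(ε • e))) = b := by
        rw [smul_neg, inv_smul_smul₀ hε.ne', map_neg, add_neg_cancel_right]
      have h1 := h (WithLp.toLp 2 (a, ε⁻¹ • (M a - y))) (WithLp.toLp 2 (b + L e, -(ε • e)))
        ⟨by
          change -(ε⁻¹ • (-(ε • e))) ∈ C (M a - ε • (ε⁻¹ • (M a - y)))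
          rwa [ht, hj], by
          change (b + L e) + L (ε⁻¹ • (-(ε • e))) ∈ D a
          rwa [hk]⟩
      rw [WithLp.prod_inner_apply] at h1
      have h2 := hcalc p.fst a q.fst (b + L e) p.snd (ε⁻¹ • (M a - y)) q.snd (-(ε • e))
      rw [ht, hj, hk] at h2
      exact h1.trans_eq h2.symm
  obtain ⟨p, hpC, hpD⟩ := hT.exists_sub_mem (WithLp.toLp 2 (w, 0))
  change -(ε⁻¹ • (0 - p.snd)) ∈ C (M p.fst - ε • p.snd) at hpC
  change w - p.fst + L (ε⁻¹ • (0 - p.snd)) ∈ D p.fst at hpD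
  simp only [zero_sub, smul_neg, neg_neg, map_neg] at hpC hpD
  refine ⟨p.fst, ε⁻¹ • p.snd, ?_, by simpa only [sub_eq_add_neg] using hpD⟩
  rwa [pow_two, mul_smul, smul_inv_smul₀ hε.ne']

theorem IsMaxMonotoneOp.exists_sub_mem_image_add {C : H → Set H} {D : G → Set G}
    (hC : IsMaxMonotoneOp C) (hD : IsMaxMonotoneOp D) (L : H →L[ℝ] G)
    {S : Submodule ℝ H} (hScl : IsClosed (S : Set H))
    (hS : coneGen (ContinuousLinearMap.adjoint L '' {v | (D v).Nonempty} - {x | (C x).Nonempty})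
      = S) (w : G) :
    ∃ v, w - v ∈ L '' C (ContinuousLinearMap.adjoint L v) + D v := by
  set M := ContinuousLinearMap.adjoint L with hM
  have hML : ∀ (v : G) (c : H), ⟪v, L c⟫ = ⟪M v, c⟫ := fun v c =>
    (ContinuousLinearMap.adjoint_inner_left L c v).symm
  have : CompleteSpace S := hScl.completeSpace_coe
  set ε : ℕ → ℝ := fun n => 1 / ((n : ℝ) + 1) with hε
  have hεpos : ∀ n, 0 < ε n := fun n => Nat.one_div_pos_of_nat
  have hεle : ∀ n, ε n ≤ 1 := fun n => by
    simp only [hε]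
    rw [div_le_one (by positivity)]
    linarith [(Nat.cast_nonneg n : (0 : ℝ) ≤ n)]
  have hεlim : Tendsto (fun n => ε n ^ 2) atTop (𝓝 0) := by
    have := (tendsto_one_div_add_atTop_nhds_zero_nat (𝕜 := ℝ)).pow 2
    rwa [zero_pow two_ne_zero] at this
  have hex : ∀ n, ∃ v c, c ∈ C (M v - ε n ^ 2 • c) ∧ w - v - L c ∈ D v := fun n =>
    hC.exists_regularized_solution hD L (hεpos n) w
  choose v c hcC hdD using hex
  have hcS : ∀ n, c n ∈ S := by
    intro n
    have h1 : ε n ^ 2 • c n ∈ S := by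
      rw [← SetLike.mem_coe, ← hS]
      refine ⟨1, zero_le_one, _, Set.sub_mem_sub ⟨v n, ⟨_, hdD n⟩, rfl⟩ ⟨_, hcC n⟩, ?_⟩
      rw [one_smul, sub_sub_cancel]
    exact (S.smul_mem_iff (pow_pos (hεpos n) 2).ne').1 h1
  have hbelow : ∀ s ∈ S, ∃ K, ∀ n, -K ≤ ⟪c n, s⟫ := by
    intro s hs
    rw [← SetLike.mem_coe, ← hS] at hs
    obtain ⟨t, ht, _, ⟨_, ⟨a, ⟨d, hd⟩, rfl⟩, y, ⟨e, he⟩, rfl⟩, rfl⟩ := hs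
    refine ⟨t * (‖e‖ ^ 2 / 4 + ‖L e + d - w - a‖ ^ 2 / 4 - ⟪w, a⟫ + ⟪e, y⟫ + ⟪d, a⟫),
      fun n => ?_⟩
    rw [real_inner_smul_right, ← mul_neg]
    refine mul_le_mul_of_nonneg_left ?_ ht
    have h1 := hC.1 _ _ _ _ (hcC n) he
    have h2 := hD.1 _ _ _ _ (hdD n) hd
    have h3 : ε n ^ 2 ≤ 1 := pow_le_one₀ (hεpos n).le (hεle n)
    have h4 : ε n ^ 2 * ⟪c n, e⟫ ≤ ε n ^ 2 * ‖c n‖ ^ 2 + ‖e‖ ^ 2 / 4 := by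
      have h5 := real_inner_le_norm (c n) e
      have h6 : ⟪c n, e⟫ ≤ ‖c n‖ ^ 2 + ‖e‖ ^ 2 / 4 := by nlinarith [sq_nonneg (‖c n‖ - ‖e‖ / 2)]
      nlinarith [mul_le_mul_of_nonneg_left h6 (sq_nonneg (ε n)), sq_nonneg ‖e‖]
    have h7 : 0 ≤ ‖v n‖ ^ 2 + ⟪v n, L e + d - w - a⟫ + ‖L e + d - w - a‖ ^ 2 / 4 := by
      have := abs_le.1 (abs_real_inner_le_norm (v n) (L e + d - w - a))
      nlinarith [sq_nonneg (‖v n‖ - ‖L e + d - w - a‖ / 2)]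
    simp only [inner_sub_left, inner_sub_right, inner_add_right, hML, map_sub,
      real_inner_smul_left, real_inner_self_eq_norm_sq] at h1 h2 h7 ⊢
    rw [real_inner_comm (M a) (c n), real_inner_comm y (c n)]
    rw [real_inner_comm a w, real_inner_comm a d, real_inner_comm y e]
    rw [real_inner_comm a (v n)] at h7
    linarith
  obtain ⟨K, hK⟩ := exists_norm_le_of_forall_bddBelow_inner S hcS hbelow
  have hK0 : 0 ≤ K := (norm_nonneg _).trans (hK 0)
  have hvsq : ∀ n m, ‖v n - v m‖ ^ 2 ≤ 2 * K ^ 2 * (ε n ^ 2 + ε m ^ 2) := by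
    intro n m
    have h1 := hC.1 _ _ _ _ (hcC n) (hcC m)
    have h2 := hD.1 _ _ _ _ (hdD n) (hdD m)
    have e1 : M (v n) - ε n ^ 2 • c n - (M (v m) - ε m ^ 2 • c m) =
        M (v n - v m) - (ε n ^ 2 • c n - ε m ^ 2 • c m) := by rw [map_sub]; abel
    have e2 : w - v n - L (c n) - (w - v m - L (c m)) = -(v n - v m) - L (c n - c m) := by
      rw [map_sub]; abel
    rw [e1, inner_sub_left] at h1
    rw [e2, inner_sub_right, hML, inner_neg_right, real_inner_self_eq_norm_sq] at h2
    have h3 : ‖ε n ^ 2 • c n - ε m ^ 2 • c m‖ ≤ (ε n ^ 2 + ε m ^ 2) * K := by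
      refine (norm_sub_le _ _).trans ?_
      rw [norm_smul, norm_smul, Real.norm_of_nonneg (sq_nonneg _),
        Real.norm_of_nonneg (sq_nonneg _), add_mul]
      gcongr <;> exact hK _
    have h4 : ‖c n - c m‖ ≤ 2 * K := (norm_sub_le _ _).trans (by linarith [hK n, hK m])
    have h5 := abs_le.1 (abs_real_inner_le_norm (ε n ^ 2 • c n - ε m ^ 2 • c m) (c n - c m))
    have h6 := mul_le_mul h3 h4 (norm_nonneg _) (by positivity)
    nlinarith
  have hcauchy : CauchySeq v := by
    rw [Metric.cauchySeq_iff']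
    intro δ hδ
    have hev : ∀ᶠ n in atTop, 4 * K ^ 2 * ε n ^ 2 < δ ^ 2 := by
      have : Tendsto (fun n => 4 * K ^ 2 * ε n ^ 2) atTop (𝓝 0) := by
        simpa using hεlim.const_mul (4 * K ^ 2)
      exact this.eventually_lt_const (by positivity)
    obtain ⟨N, hN⟩ := hev.exists
    refine ⟨N, fun n hn => ?_⟩
    rw [dist_eq_norm]
    refine lt_of_pow_lt_pow_left₀ 2 hδ.le ?_
    have h1 : ε n ^ 2 ≤ ε N ^ 2 :=
      pow_le_pow_left₀ (hεpos n).le (Nat.one_div_le_one_div hn) 2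
    nlinarith [hvsq n N, mul_le_mul_of_nonneg_left h1 (sq_nonneg K)]
  obtain ⟨v₀, hv₀⟩ := cauchySeq_tendsto_of_complete hcauchy
  set l : Ultrafilter ℕ := Ultrafilter.of atTop with hl
  have hl' : (l : Filter ℕ) ≤ atTop := Ultrafilter.of_le atTop
  obtain ⟨c₀, hc₀⟩ := exists_weak_limit_of_bounded hK l
  have hεc : Tendsto (fun n => ε n ^ 2 • c n) atTop (𝓝 0) := by
    refine squeeze_zero_norm (a := fun n => ε n ^ 2 * K) (fun n => ?_)
      (by simpa using hεlim.mul_const K)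
    rw [norm_smul, Real.norm_of_nonneg (sq_nonneg _)]
    exact mul_le_mul_of_nonneg_left (hK n) (sq_nonneg _)
  have hMv : Tendsto (fun n => M (v n) - ε n ^ 2 • c n) atTop (𝓝 (M v₀)) := by
    simpa using ((M.continuous.tendsto v₀).comp hv₀).sub hεc
  have hmemC : c₀ ∈ C (M v₀) := hC.mem_of_tendsto_of_weak hcC (hMv.mono_left hl') hK hc₀
  obtain ⟨R, hR⟩ := hv₀.norm.bddAbove_range
  have hdK : ∀ n, ‖w - v n - L (c n)‖ ≤ ‖w‖ + R + ‖L‖ * K := fun n => by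
    refine (norm_sub_le _ _).trans (add_le_add ((norm_sub_le _ _).trans ?_) ?_)
    · exact add_le_add_right (hR ⟨n, rfl⟩) _
    · exact (L.le_opNorm _).trans (mul_le_mul_of_nonneg_left (hK n) (norm_nonneg _))
  have hd₀ : ∀ g : G, Tendsto (fun n => ⟪w - v n - L (c n), g⟫) l (𝓝 ⟪w - v₀ - L c₀, g⟫) := by
    intro g
    have h1 : Tendsto (fun n => ⟪w - v n, g⟫) l (𝓝 ⟪w - v₀, g⟫) :=
      ((hv₀.mono_left hl').const_sub w).inner tendsto_const_nhds
    have h2 := h1.sub (hc₀ (M g))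
    simpa only [inner_sub_left _ (L _), hM, ContinuousLinearMap.adjoint_inner_right] using h2
  have hmemD : w - v₀ - L c₀ ∈ D v₀ := hD.mem_of_tendsto_of_weak hdD (hv₀.mono_left hl') hdK hd₀
  exact ⟨v₀, L c₀, ⟨c₀, hmemC, rfl⟩, _, hmemD, add_sub_cancel _ _⟩

theorem IsMonotoneOp.image_adjoint_add {C : H → Set H} {D : G → Set G} (hC : IsMonotoneOp C)
    (hD : IsMonotoneOp D) (L : H →L[ℝ] G) :
    IsMonotoneOp fun v => L '' C (ContinuousLinearMap.adjoint L v) + D v := by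
  rintro x y _ _ ⟨_, ⟨c, hc, rfl⟩, d, hd, rfl⟩ ⟨_, ⟨c', hc', rfl⟩, d', hd', rfl⟩
  have h1 := hC _ _ _ _ hc hc'
  have h2 := hD _ _ _ _ hd hd'
  rw [← map_sub, ContinuousLinearMap.adjoint_inner_left, map_sub] at h1
  simp only [add_sub_add_comm, inner_add_right]
  exact add_nonneg h1 h2

end SumRule

/-- if `A`, `B` are maximally monotone and the cone generated by
`L*(ran B) − ran A` is a closed vector subspace, then `(L ▷ A) □ B` is
maximally monotone. -/
theorem isMaxMonotoneOp_parSum_parComp {H G : Type*}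
    [NormedAddCommGroup H] [InnerProductSpace ℝ H] [CompleteSpace H]
    [NormedAddCommGroup G] [InnerProductSpace ℝ G] [CompleteSpace G]
    (A : H → Set H) (B : G → Set G) (L : H →L[ℝ] G)
    (hA : IsMaxMonotoneOp A) (hB : IsMaxMonotoneOp B)
    (hq : IsClosedSubspaceCone (ContinuousLinearMap.adjoint L '' SVRan B - SVRan A)) :
    IsMaxMonotoneOp (parSum (parComp L A) B) := by
  obtain ⟨S, hScl, hS⟩ := hq
  rw [svRan_eq_setOf_svInv_nonempty, svRan_eq_setOf_svInv_nonempty] at hS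
  have hsum := (hA.svInv.1.image_adjoint_add hB.svInv.1 L).isMaxMonotoneOp_of_exists_sub_mem
    fun w => hA.svInv.exists_sub_mem_image_add hB.svInv L hScl hS w
  exact hsum.svInv
end
end

section
/- Let H, G be real Hilbert spaces, A : H → 2^H maximally monotone, L : H → G bounded linear, and suppose the cone generated by ran L* + ran A is a closed vector subspace. Then L ▷ A = (L ∘ A⁻¹ ∘ L*)⁻¹ is maximally monotone. -/
open scoped Pointwise RealInnerProductSpace

noncomputable section

section Maximality

variable {H : Type*} [NormedAddCommGroup H] [InnerProductSpace ℝ H]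

/-- A point monotonically related to the graph of a maximally monotone operator lies in it. -/
lemma IsMaxMonotoneOp.mem_of_forall_inner_nonneg {A : H → Set H} (hA : IsMaxMonotoneOp A)
    {x u : H} (h : ∀ y v, v ∈ A y → (0 : ℝ) ≤ ⟪x - y, u - v⟫) : u ∈ A x := by
  have hB : (fun y => A y ∪ {v | y = x ∧ v = u}) = A := by
    refine hA.2 _ ?_ fun y => Set.subset_union_left
    rintro y₁ y₂ v₁ v₂ (h₁ | ⟨rfl, rfl⟩) (h₂ | ⟨rfl, rfl⟩)
    · exact hA.1 _ _ _ _ h₁ h₂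
    · have := h _ _ h₁
      rwa [← neg_sub y₁, ← neg_sub v₁, inner_neg_neg] at this
    · exact h _ _ h₂
    · simp
  rw [← hB]
  exact Or.inr ⟨rfl, rfl⟩

/-- A monotone operator `C` such that `Id + C` is surjective is maximally monotone. -/
lemma IsMonotoneOp.isMaxMonotoneOp_of_surjective {C : H → Set H} (hC : IsMonotoneOp C)
    (hsurj : ∀ w, ∃ y, w - y ∈ C y) : IsMaxMonotoneOp C := by
  refine ⟨hC, fun B hB hCB => funext fun x => (Set.Subset.antisymm ?_ (hCB x))⟩
  intro u hu
  obtain ⟨y, hy⟩ := hsurj (x + u)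
  have h := hB x y u _ hu (hCB y hy)
  have hxy : x = y := by
    rw [show u - (x + u - y) = -(x - y) by abel, inner_neg_right,
      real_inner_self_eq_norm_sq] at h
    have : ‖x - y‖ = 0 := by nlinarith [norm_nonneg (x - y)]
    exact sub_eq_zero.1 (norm_eq_zero.1 this)
  subst hxy
  simpa using hy

end Maximality

section Minty

variable {H : Type*} [NormedAddCommGroup H] [InnerProductSpace ℝ H] {P : H →L[ℝ] H}

/-- A convex set above the concave quadratic `q ↦ -⟪q, P q⟫ / 4` lies above one of its tangents. -/
lemma exists_tangent_le_of_convex [CompleteSpace H] (hsymm : ∀ x y, ⟪x, P y⟫ = ⟪P x, y⟫)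
    (hpos : ∀ x, (0 : ℝ) ≤ ⟪x, P x⟫) (hsurj : Function.Surjective P)
    {F : Set (H × ℝ)} (hF : Convex ℝ F) (hne : F.Nonempty)
    (hle : ∀ e ∈ F, 0 ≤ ⟪e.1, P e.1⟫ / 4 + e.2) :
    ∃ q₀, ∀ e ∈ F, ⟪q₀, P q₀⟫ ≤ ⟪q₀, P e.1⟫ + e.2 := by
  have hconc : ConcaveOn ℝ Set.univ fun q : H => -(⟪q, P q⟫ / 4) := by
    refine ⟨convex_univ, fun x _ y _ a b ha hb hab => ?_⟩
    have h := mul_nonneg (mul_nonneg ha hb) (hpos (x - y))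
    have hyx : ⟪y, P x⟫ = ⟪x, P y⟫ := by rw [hsymm, real_inner_comm]
    simp only [map_sub, map_add, map_smul, inner_sub_left, inner_sub_right, inner_add_left,
      inner_add_right, real_inner_smul_left, real_inner_smul_right, smul_eq_mul, hyx] at h ⊢
    obtain rfl : b = 1 - a := by linarith
    nlinarith
  have hopen : IsOpen {p : H × ℝ | p.1 ∈ Set.univ ∧ p.2 < -(⟪p.1, P p.1⟫ / 4)} := by
    simp only [Set.mem_univ, true_and]
    exact isOpen_lt (by fun_prop) (by fun_prop)
  obtain ⟨f, c, hlt, hge⟩ := geometric_hahn_banach_open hconc.convex_strict_hypograph hopen hF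
    (Set.disjoint_left.2 fun e he he' => by linarith [hle e he', he.2])
  obtain ⟨ℓ, hℓ⟩ := (InnerProductSpace.toDual ℝ H).surjective
    (f.comp (ContinuousLinearMap.inl ℝ H ℝ))
  set β := f (0, 1) with hβ
  have hf : ∀ q t, f (q, t) = ⟪ℓ, q⟫ + t * β := by
    intro q t
    have h₁ : ⟪ℓ, q⟫ = f (q, 0) := by
      rw [← InnerProductSpace.toDual_apply_apply (𝕜 := ℝ), hℓ]; rfl
    have h₂ : (q, t) = (q, (0 : ℝ)) + t • ((0 : H), (1 : ℝ)) := by simp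
    rw [h₂, map_add, map_smul, h₁, smul_eq_mul]
  have hlow : ∀ q t, t < -(⟪q, P q⟫ / 4) → ⟪ℓ, q⟫ + t * β < c := fun q t ht => by
    rw [← hf]; exact hlt _ ⟨trivial, ht⟩
  have hupp : ∀ e ∈ F, c ≤ ⟪ℓ, e.1⟫ + e.2 * β := fun e he => by
    rw [← hf]; exact hge _ he
  have hβpos : 0 < β := by
    obtain ⟨e, he⟩ := hne
    by_contra! hneg
    have h₁ := hlow e.1 (min e.2 (-(⟪e.1, P e.1⟫ / 4) - 1))
      (by linarith [min_le_right e.2 (-(⟪e.1, P e.1⟫ / 4) - 1)])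
    nlinarith [hupp e he, min_le_left e.2 (-(⟪e.1, P e.1⟫ / 4) - 1)]
  obtain ⟨q₀, hq₀⟩ := hsurj (β⁻¹ • ℓ)
  have hℓq : ∀ q, ⟪ℓ, q⟫ = β * ⟪q₀, P q⟫ := fun q => by
    rw [hsymm, hq₀, real_inner_smul_left, mul_inv_cancel_left₀ hβpos.ne']
  refine ⟨q₀, fun e he => ?_⟩
  have hmax : β * ⟪q₀, P q₀⟫ ≤ c := by
    refine le_of_forall_pos_lt_add fun ε hε => ?_
    have h := hlow ((2 : ℝ) • q₀) (-⟪q₀, P q₀⟫ - ε / β) (by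
      have : 0 < ε / β := by positivity
      simp only [map_smul, real_inner_smul_left, real_inner_smul_right]
      linarith)
    rw [hℓq, map_smul, real_inner_smul_right, sub_mul, div_mul_cancel₀ _ hβpos.ne'] at h
    linarith
  have h := hupp e he
  rw [hℓq] at h
  exact le_of_mul_le_mul_left (by linarith) hβpos

/-- Convex combinations of the points `(a, c, ⟪a, P c⟫)` of a monotone graph lie above the
pairing. -/
lemma inner_le_of_mem_convexHull {Γ : Set (H × H)}
    (hΓ : ∀ p ∈ Γ, ∀ q ∈ Γ, (0 : ℝ) ≤ ⟪p.1 - q.1, P (p.2 - q.2)⟫) {e : H × H × ℝ}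
    (he : e ∈ convexHull ℝ ((fun p : H × H => (p.1, p.2, (⟪p.1, P p.2⟫ : ℝ))) '' Γ)) :
    ⟪e.1, P e.2.1⟫ ≤ e.2.2 := by
  have hconv : ∀ d : H × H × ℝ, Convex ℝ
      {e : H × H × ℝ | 0 ≤ e.2.2 + d.2.2 - ⟪e.1, P d.2.1⟫ - ⟪d.1, P e.2.1⟫} := by
    intro d x hx y hy a b ha hb hab
    have h := add_nonneg (mul_nonneg ha hx) (mul_nonneg hb hy)
    obtain rfl : b = 1 - a := by linarith
    simp only [Set.mem_ofPred_eq, Prod.fst_add, Prod.snd_add, Prod.smul_fst, Prod.smul_snd,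
      map_add, map_smul, inner_add_left, inner_add_right, real_inner_smul_left,
      real_inner_smul_right, smul_eq_mul]
    linarith
  have hgen : ∀ d ∈ Γ, ∀ x ∈ convexHull ℝ
      ((fun p : H × H => (p.1, p.2, (⟪p.1, P p.2⟫ : ℝ))) '' Γ),
      0 ≤ x.2.2 + ⟪d.1, P d.2⟫ - ⟪x.1, P d.2⟫ - ⟪d.1, P x.2.1⟫ := by
    intro d hd x hx
    refine convexHull_min ?_ (hconv (d.1, d.2, ⟪d.1, P d.2⟫)) hx
    rintro _ ⟨p, hp, rfl⟩
    have h := hΓ p hp d hd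
    simp only [map_sub, inner_sub_left, inner_sub_right] at h
    simp only [Set.mem_ofPred_eq]
    linarith
  have h : 0 ≤ e.2.2 + e.2.2 - ⟪e.1, P e.2.1⟫ - ⟪e.1, P e.2.1⟫ := by
    refine convexHull_min ?_ (hconv e) he
    rintro _ ⟨p, hp, rfl⟩
    have h := hgen p hp e he
    simp only [Set.mem_ofPred_eq]
    linarith
  linarith

/-- Every monotone graph admits a point `(u, -u)` monotonically related to it, with respect to
the pairing `⟪·, P ·⟫`. -/
lemma exists_inner_nonpos_of_monotone [CompleteSpace H] (hsymm : ∀ x y, ⟪x, P y⟫ = ⟪P x, y⟫)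
    (hpos : ∀ x, (0 : ℝ) ≤ ⟪x, P x⟫) (hsurj : Function.Surjective P) {Γ : Set (H × H)}
    (hΓ : ∀ p ∈ Γ, ∀ q ∈ Γ, (0 : ℝ) ≤ ⟪p.1 - q.1, P (p.2 - q.2)⟫) :
    ∃ u, ∀ p ∈ Γ, ⟪u - p.1, P (u + p.2)⟫ ≤ 0 := by
  obtain rfl | hne := Γ.eq_empty_or_nonempty
  · exact ⟨0, by simp⟩
  let T : H × H × ℝ →ₗ[ℝ] H × ℝ :=
    { toFun := fun e => (e.2.1 - e.1, e.2.2)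
      map_add' := fun x y => by ext <;> simp; abel
      map_smul' := fun a x => by ext <;> simp [smul_sub] }
  obtain ⟨q₀, hq₀⟩ := exists_tangent_le_of_convex hsymm hpos hsurj
    ((convex_convexHull ℝ
      ((fun p : H × H => (p.1, p.2, (⟪p.1, P p.2⟫ : ℝ))) '' Γ)).linear_image T)
    ((hne.image _).convexHull.image T) (by
      rintro _ ⟨e, he, rfl⟩
      have h₁ := inner_le_of_mem_convexHull hΓ he
      have h₂ := hpos (e.1 + e.2.1)
      have h₃ : ⟪e.2.1, P e.1⟫ = ⟪e.1, P e.2.1⟫ := by rw [hsymm, real_inner_comm]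
      change 0 ≤ ⟪e.2.1 - e.1, P (e.2.1 - e.1)⟫ / 4 + e.2.2
      simp only [map_add, map_sub, inner_add_left, inner_add_right, inner_sub_left,
        inner_sub_right, h₃] at h₂ ⊢
      linarith)
  refine ⟨-q₀, fun p hp => ?_⟩
  have h : ⟪q₀, P q₀⟫ ≤ ⟪q₀, P (p.2 - p.1)⟫ + ⟪p.1, P p.2⟫ :=
    hq₀ _ ⟨_, subset_convexHull ℝ _ ⟨p, hp, rfl⟩, rfl⟩
  have h₃ : ⟪p.1, P q₀⟫ = ⟪q₀, P p.1⟫ := by rw [hsymm, real_inner_comm]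
  simp only [map_add, map_sub, map_neg, inner_add_right, inner_sub_left, inner_sub_right,
    inner_neg_left, inner_neg_right, h₃] at h ⊢
  linarith

/-- **Minty's theorem**, with a symmetric positive surjective operator in place of the identity. -/
lemma IsMaxMonotoneOp.exists_sub_mem_s11 [CompleteSpace H] {A : H → Set H} (hA : IsMaxMonotoneOp A)
    (hsymm : ∀ x y, ⟪x, P y⟫ = ⟪P x, y⟫)
    (hpos : ∀ x, (0 : ℝ) ≤ ⟪x, P x⟫) (hsurj : Function.Surjective P) (h : H) :
    ∃ u, h - P u ∈ A u := by
  obtain ⟨u, hu⟩ := exists_inner_nonpos_of_monotone hsymm hpos hsurj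
    (Γ := {p | h + P p.2 ∈ A p.1}) fun p hp q hq => by
      simpa using hA.1 _ _ _ _ hp hq
  refine ⟨u, hA.mem_of_forall_inner_nonneg fun a x hx => ?_⟩
  obtain ⟨c, hc⟩ := hsurj (x - h)
  have := hu (a, c) (by simpa [hc] using hx)
  rw [map_add, hc] at this
  rw [show h - P u - x = -(P u + (x - h)) by abel, inner_neg_right]
  exact neg_nonneg.2 this

end Minty

section Regularization

variable {H G : Type*} [NormedAddCommGroup H] [InnerProductSpace ℝ H] [CompleteSpace H]
  [NormedAddCommGroup G] [InnerProductSpace ℝ G] [CompleteSpace G]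

open Filter Topology ContinuousLinearMap

/-- A bounded sequence in a Hilbert space converges weakly along the hyperfilter. -/
lemma exists_tendsto_inner_hyperfilter {u : ℕ → H} {C : ℝ} (hu : ∀ n, ‖u n‖ ≤ C) :
    ∃ x, ∀ z, Tendsto (fun n => (⟪u n, z⟫ : ℝ)) (hyperfilter ℕ) (𝓝 ⟪x, z⟫) := by
  let φ : ℕ → WeakDual ℝ H := fun n =>
    StrongDual.toWeakDual (InnerProductSpace.toDual ℝ H (u n))
  obtain ⟨ψ, -, hψ⟩ := (WeakDual.isCompact_closedBall (𝕜 := ℝ) (E := H) 0 C).ultrafilter_le_nhds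
    ((hyperfilter ℕ).map φ) (by
      refine le_principal_iff.2 (mem_map.2 (Eventually.of_forall fun n => ?_))
      simpa [φ] using hu n)
  refine ⟨(InnerProductSpace.toDual ℝ H).symm (WeakDual.toStrongDual ψ), fun z => ?_⟩
  have h := ((WeakDual.eval_continuous z).tendsto ψ).comp
    (show Tendsto φ (hyperfilter ℕ) (𝓝 ψ) from hψ)
  simpa [φ, Function.comp_def] using h

/-- The regularized inclusion `L* w ∈ A u + ε u + L* L u` has a solution. -/
lemma IsMaxMonotoneOp.exists_regularized {A : H → Set H} (hA : IsMaxMonotoneOp A)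
    (L : H →L[ℝ] G) (w : G) {ε : ℝ} (hε : 0 < ε) :
    ∃ u, adjoint L (w - L u) - ε • u ∈ A u := by
  let P : H →L[ℝ] H := ε • ContinuousLinearMap.id ℝ H + (adjoint L).comp L
  have hP : ∀ x, P x = ε • x + adjoint L (L x) := fun x => rfl
  have hself : ∀ x, (⟪x, P x⟫ : ℝ) = ε * ‖x‖ ^ 2 + ‖L x‖ ^ 2 := fun x => by
    rw [hP, inner_add_right, real_inner_smul_right, adjoint_inner_right,
      real_inner_self_eq_norm_sq, real_inner_self_eq_norm_sq]
  have hcoer : IsCoercive ((innerSL ℝ).comp P) := by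
    refine ⟨ε, hε, fun x => ?_⟩
    have : ((innerSL ℝ).comp P) x x = ⟪x, P x⟫ := real_inner_comm _ _
    rw [this, hself]
    nlinarith [sq_nonneg ‖L x‖]
  have hsurj : Function.Surjective P := fun y => by
    obtain ⟨x, hx⟩ := hcoer.continuousLinearEquivOfBilin.surjective y
    refine ⟨x, ?_⟩
    rw [← hx]
    exact hcoer.unique_continuousLinearEquivOfBilin fun z => rfl
  obtain ⟨u, hu⟩ := hA.exists_sub_mem_s11 (P := P)
    (fun x y => by
      rw [hP, hP, inner_add_left, inner_add_right, real_inner_smul_left, real_inner_smul_right,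
        adjoint_inner_left, adjoint_inner_right])
    (fun x => by rw [hself]; positivity) hsurj (adjoint L w)
  refine ⟨u, ?_⟩
  convert hu using 1
  rw [hP, map_sub]
  abel

/-- Solutions of the regularized inclusions are bounded above on `ran L* + ran A`, uniformly in
the regularization parameter. -/
lemma IsMonotoneOp.exists_inner_le_of_regularized {A : H → Set H} (hA : IsMonotoneOp A)
    (L : H →L[ℝ] G) (w : G) {z : H} (hz : z ∈ Set.range (adjoint L) + SVRan A) :
    ∃ K : ℝ, ∀ (ε : ℝ) (u : H), 0 ≤ ε → ε ≤ 1 → adjoint L (w - L u) - ε • u ∈ A u →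
      ⟪u, z⟫ ≤ K := by
  obtain ⟨_, ⟨g, rfl⟩, x, hx, rfl⟩ := hz
  obtain ⟨a, hax⟩ := Set.mem_iUnion.1 hx
  refine ⟨‖w + L a + g‖ ^ 2 + ‖a‖ ^ 2 + ⟪a, x⟫ - ⟪L a, w⟫, fun ε u hε hε' hu => ?_⟩
  have h := hA _ _ _ _ hu hax
  have h₁ : (0 : ℝ) ≤ ‖L u - (w + L a + g)‖ ^ 2 + ‖L u‖ ^ 2 := by positivity
  have h₂ : (0 : ℝ) ≤ ε * (‖u - a‖ ^ 2 + ‖u‖ ^ 2) := by positivity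
  have h₃ : ε * ‖a‖ ^ 2 ≤ ‖a‖ ^ 2 := mul_le_of_le_one_left (by positivity) hε'
  have h₄ : 0 ≤ ‖w + L a + g‖ ^ 2 := by positivity
  have h₅ : 0 ≤ ‖a‖ ^ 2 := by positivity
  rw [norm_sub_sq_real] at h₁ h₂
  simp only [map_sub, inner_add_right, inner_sub_left, inner_sub_right, real_inner_smul_right,
    adjoint_inner_right, real_inner_self_eq_norm_sq, real_inner_comm (L u) (L a),
    real_inner_comm u a] at h h₁ h₂ ⊢
  nlinarith

/-- Under the qualification condition, solutions of the regularized inclusions are bounded. -/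
lemma IsMonotoneOp.exists_norm_le_of_regularized {A : H → Set H} (hA : IsMonotoneOp A)
    (L : H →L[ℝ] G) (hq : IsClosedSubspaceCone (Set.range (adjoint L) + SVRan A)) (w : G)
    {ε : ℕ → ℝ} (hε : ∀ n, 0 < ε n) (hε' : ∀ n, ε n ≤ 1) {u : ℕ → H}
    (hu : ∀ n, adjoint L (w - L (u n)) - ε n • u n ∈ A (u n)) : ∃ C, ∀ n, ‖u n‖ ≤ C := by
  obtain ⟨S, hS, hcone⟩ := hq
  have hDS : Set.range (adjoint L) + SVRan A ⊆ S := fun z hz => by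
    rw [← hcone]
    exact ⟨1, zero_le_one, z, hz, (one_smul ℝ z).symm⟩
  have hAS : ∀ x ∈ SVRan A, x ∈ S := fun x hx =>
    hDS ⟨0, ⟨0, map_zero _⟩, x, hx, zero_add x⟩
  have hran : ∀ n, adjoint L (w - L (u n)) - ε n • u n ∈ SVRan A := fun n =>
    Set.mem_iUnion.2 ⟨_, hu n⟩
  have hLS : ∀ g, adjoint L g ∈ S := fun g => by
    have h := S.sub_mem (hDS ⟨_, ⟨g, rfl⟩, _, hran 0, rfl⟩) (hAS _ (hran 0))
    simpa using h
  have huS : ∀ n, u n ∈ S := fun n => by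
    have h := S.sub_mem (hLS (w - L (u n))) (hAS _ (hran n))
    rw [sub_sub_cancel] at h
    exact (S.smul_mem_iff (hε n).ne').1 h
  have hbdd : ∀ z ∈ S, ∃ K : ℝ, ∀ n, ⟪u n, z⟫ ≤ K := by
    intro z hz
    rw [← SetLike.mem_coe, ← hcone] at hz
    obtain ⟨c, hc, y, hy, rfl⟩ := hz
    obtain ⟨K, hK⟩ := hA.exists_inner_le_of_regularized L w hy
    refine ⟨c * K, fun n => ?_⟩
    rw [real_inner_smul_right]
    exact mul_le_mul_of_nonneg_left (hK _ _ (hε n).le (hε' n) (hu n)) hc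
  have : CompleteSpace S := hS.completeSpace_coe
  obtain ⟨C, hC⟩ := banach_steinhaus (g := fun n => innerSL ℝ (u n)) fun z => by
    obtain ⟨K₁, hK₁⟩ := hbdd (S.starProjection z) (S.starProjection_apply_mem z)
    obtain ⟨K₂, hK₂⟩ := hbdd (-S.starProjection z) (S.neg_mem (S.starProjection_apply_mem z))
    refine ⟨max K₁ K₂, fun n => ?_⟩
    have hz : (⟪u n, z⟫ : ℝ) = ⟪u n, S.starProjection z⟫ := by
      rw [← S.inner_starProjection_left_eq_right, S.starProjection_eq_self_iff.2 (huS n)]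
    rw [innerSL_apply_apply, hz, Real.norm_eq_abs]
    refine abs_le'.2 ⟨(hK₁ n).trans (le_max_left _ _), ?_⟩
    rw [← inner_neg_right]
    exact (hK₂ n).trans (le_max_right _ _)
  exact ⟨C, fun n => by simpa using hC n⟩

/-- Under the qualification condition, the inclusion `L* (w - L u) ∈ A u` has a solution. -/
lemma IsMaxMonotoneOp.exists_adjoint_sub_mem {A : H → Set H} (hA : IsMaxMonotoneOp A)
    (L : H →L[ℝ] G) (hq : IsClosedSubspaceCone (Set.range (adjoint L) + SVRan A)) (w : G) :
    ∃ u, adjoint L (w - L u) ∈ A u := by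
  have hε : ∀ n : ℕ, 0 < 1 / ((n : ℝ) + 1) := fun n => by positivity
  have hε' : ∀ n : ℕ, 1 / ((n : ℝ) + 1) ≤ 1 := fun n => by
    rw [div_le_one (by positivity)]
    linarith [n.cast_nonneg (α := ℝ)]
  choose u hu using fun n : ℕ => hA.exists_regularized L w (hε n)
  obtain ⟨C, hC⟩ := hA.1.exists_norm_le_of_regularized L hq w hε hε' hu
  obtain ⟨u₀, hu₀⟩ := exists_tendsto_inner_hyperfilter hC
  refine ⟨u₀, hA.mem_of_forall_inner_nonneg fun a x hx => ?_⟩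
  have hLu : ∀ g, Tendsto (fun n => (⟪L (u n), g⟫ : ℝ)) (hyperfilter ℕ) (𝓝 ⟪L u₀, g⟫) :=
    fun g => by simpa only [adjoint_inner_right] using hu₀ (adjoint L g)
  have hεlim : Tendsto (fun n : ℕ => 1 / ((n : ℝ) + 1)) (hyperfilter ℕ) (𝓝 0) :=
    tendsto_one_div_add_atTop_nhds_zero_nat.mono_left Nat.hyperfilter_le_atTop
  -- The term `-‖L (u n)‖ ^ 2` is replaced by its affine majorant at `L u₀`.
  have hlim := (((((hLu w).sub ((hLu (L u₀)).const_mul 2)).add_const (‖L u₀‖ ^ 2)).sub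
    (hu₀ x)).add ((hLu (L a)).add (hεlim.mul (hu₀ a)))).add_const (⟪a, x⟫ - ⟪L a, w⟫)
  have hnonneg := ge_of_tendsto' hlim fun n => show (0 : ℝ) ≤ _ by
    have h := hA.1 _ _ _ _ (hu n) hx
    have h₁ : (0 : ℝ) ≤ ‖L (u n) - L u₀‖ ^ 2 := by positivity
    have h₂ : 0 ≤ 1 / ((n : ℝ) + 1) * ‖u n‖ ^ 2 := mul_nonneg (hε n).le (by positivity)
    rw [norm_sub_sq_real] at h₁
    simp only [map_sub, inner_sub_left, inner_sub_right, real_inner_smul_right,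
      adjoint_inner_right, real_inner_self_eq_norm_sq, real_inner_comm (L (u n)) (L a),
      real_inner_comm (u n) a] at h
    linarith
  simp only [map_sub, inner_sub_left, inner_sub_right, adjoint_inner_right,
    real_inner_self_eq_norm_sq, real_inner_comm (L u₀) (L a)] at hnonneg ⊢
  linarith

/-- Parallel composition preserves monotonicity. -/
lemma IsMonotoneOp.parComp {A : H → Set H} (hA : IsMonotoneOp A) (L : H →L[ℝ] G) :
    IsMonotoneOp (parComp L A) := by
  rintro _ _ u v ⟨x, hx, rfl⟩ ⟨y, hy, rfl⟩
  have h := hA _ _ _ _ hx hy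
  rwa [← map_sub, adjoint_inner_right, map_sub] at h

end Regularization

/-- if `A` is maximally monotone and the cone generated by
`ran L* + ran A` is a closed vector subspace, then `L ▷ A` is maximally
monotone. -/
theorem isMaxMonotoneOp_parComp {H G : Type*}
    [NormedAddCommGroup H] [InnerProductSpace ℝ H] [CompleteSpace H]
    [NormedAddCommGroup G] [InnerProductSpace ℝ G] [CompleteSpace G]
    (A : H → Set H) (L : H →L[ℝ] G) (hA : IsMaxMonotoneOp A)
    (hq : IsClosedSubspaceCone (Set.range (ContinuousLinearMap.adjoint L) + SVRan A)) :
    IsMaxMonotoneOp (parComp L A) := by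
  refine (hA.1.parComp L).isMaxMonotoneOp_of_surjective fun w => ?_
  obtain ⟨u, hu⟩ := hA.exists_adjoint_sub_mem L hq w
  exact ⟨L u, u, hu, rfl⟩
end
end
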